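/- Let A be a finite abelian probability group with |A| = m+1. Then in ℂ[A] ⊗_ℂ ℂ[A] one has Σ_{j=0}^{m} n_j·(F_j ⊗ F_j) = Σ_{a∈A} a ⊗ (h_a·a*). -/

import Mathlib

open Finset

/-- A probability group: a finite set `A` with `p : A × A × A → ℝ`
(written `p a b c` for `p(a.b = c)`), an identity element `one` and an
involution `star` satisfying the axioms of Harrison. -/
structure ProbabilityGroup (A : Type*) [Fintype A] where
  /-- the structure function `p(a.b = c)` -/
  p : A → A → A → ℝ
  /-- the identity element `1` -/
  one : A
  /-- the involution `a ↦ a*` -/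
  star : A → A
  nonneg : ∀ a b c, 0 ≤ p a b c
  sum_eq_one : ∀ a b, ∑ c, p a b c = 1
  assoc : ∀ a b c d, ∑ x, p a b x * p x c d = ∑ y, p a y d * p b c y
  one_mul : ∀ a, p one a a = 1
  mul_one : ∀ a, p a one a = 1
  star_pos : ∀ b, 0 < p b (star b) one
  star_unique : ∀ b b', 0 < p b b' one → b' = star b
  p_star : ∀ a b c, p a b c = p (star b) (star a) (star c)
  star_symm : ∀ a, p a (star a) one = p (star a) a one

variable {A : Type*} [Fintype A] [DecidableEq A]

/-- The multiplication of `ℂ[A]` (realized as `A → ℂ` via coordinates in the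
basis `A`): on basis elements, `a·b = ∑ c, p(a.b = c) • c`. -/
noncomputable def Pmul (G : ProbabilityGroup A) (f g : A → ℂ) : A → ℂ :=
  fun c => ∑ a : A, ∑ b : A, f a * g b * (G.p a b c : ℂ)

/-- The basis element of `ℂ[A]` corresponding to `a ∈ A`. -/
def delta (a : A) : A → ℂ := fun c => if c = a then 1 else 0

/-- The weight `h_a := 1 / p(a.a* = 1)`. -/
noncomputable def wt (G : ProbabilityGroup A) (a : A) : ℝ :=
  1 / G.p a (G.star a) G.one

/-- The total weight `n(A) := ∑ a, h_a`. -/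
noncomputable def nPG (G : ProbabilityGroup A) : ℝ := ∑ a : A, wt G a

/-- The normalized idempotent `u_A := (1/n(A)) ∑ a, h_a • a`. -/
noncomputable def uA (G : ProbabilityGroup A) : A → ℂ :=
  fun a => ((wt G a / nPG G : ℝ) : ℂ)

namespace ProbabilityGroup

theorem star_star {A : Type*} [Fintype A] (G : ProbabilityGroup A) (a : A) :
    G.star (G.star a) = a := by
  symm
  apply G.star_unique
  rw [← G.star_symm]
  exact G.star_pos a

theorem p_one_eq_zero {A : Type*} [Fintype A] (G : ProbabilityGroup A) {a b : A}
    (h : b ≠ G.star a) : G.p a b G.one = 0 := by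
  by_contra h0
  exact h (G.star_unique a b (lt_of_le_of_ne (G.nonneg a b G.one) (Ne.symm h0)))

/-- The coefficient of the identity in `a · f`. -/
theorem Pmul_delta_one {A : Type*} [Fintype A] [DecidableEq A] (G : ProbabilityGroup A)
    (a : A) (f : A → ℂ) :
    Pmul G (delta a) f G.one = f (G.star a) * (G.p a (G.star a) G.one : ℂ) := by
  unfold Pmul delta
  rw [Finset.sum_eq_single a (by intro b _ hb; simp [hb]) (by simp),
    Finset.sum_eq_single (G.star a) (by intro b _ hb; simp [G.p_one_eq_zero hb]) (by simp)]
  simp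

end ProbabilityGroup

theorem sum_smul_delta {A : Type*} [Fintype A] [DecidableEq A] (f : A → ℂ) :
    ∑ a, f a • delta a = f := by
  ext c
  simp [delta]

/-- A family of vectors with a dual family of functionals, of cardinality the dimension,
expands every vector. -/
theorem sum_dual_smul_eq {K V ι : Type*} [Field K] [AddCommGroup V] [Module K V]
    [FiniteDimensional K V]
    [Fintype ι] [DecidableEq ι] (μ : ι → V → K) (hμ : ∀ i, IsLinearMap K (μ i)) (F : ι → V)
    (hF : ∀ i j, μ i (F j) = if i = j then 1 else 0)
    (hcard : Fintype.card ι = Module.finrank K V) (x : V) :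
    ∑ i, μ i x • F i = x := by
  have key (c : ι → K) (i : ι) : μ i (∑ j, c j • F j) = c i := by
    change (hμ i).mk' (μ i) (∑ j, c j • F j) = c i
    simp [hF]
  have hli : LinearIndependent K F := by
    rw [Fintype.linearIndependent_iff]
    intro c hc i
    rw [← key c i, hc, (hμ i).map_zero]
  have hx : x ∈ Submodule.span K (Set.range F) := by
    rw [hli.span_eq_top_of_card_eq_finrank' hcard]
    trivial
  obtain ⟨c, rfl⟩ := (Submodule.mem_span_range_iff_exists_fun K).1 hx
  simp only [key]

open TensorProduct in
/-- For a finite abelian probability group `A` with `|A| = m+1`,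
in `ℂ[A] ⊗_ℂ ℂ[A]` one has `∑_{j=0}^m n_j·(F_j ⊗ F_j) = ∑_{a∈A} a ⊗ (h_a·a*)`. -/
theorem stmt_5 {A : Type*} [Fintype A] [DecidableEq A] (m : ℕ)
    (G : ProbabilityGroup A)
    -- `A` is abelian
    (hab : ∀ a b c : A, G.p a b c = G.p b a c)
    -- `|A| = m + 1`
    (hcard : Fintype.card A = m + 1)
    -- `μ_0, …, μ_m` are the distinct `ℂ`-algebra homomorphisms `ℂ[A] → ℂ`:
    (μ : Fin (m + 1) → (A → ℂ) → ℂ)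
    (hμlin : ∀ j, IsLinearMap ℂ (μ j))
    (hμmul : ∀ j, ∀ x y : A → ℂ, μ j (Pmul G x y) = μ j x * μ j y)
    (hμunit : ∀ j, μ j (delta G.one) = 1)
    (hμinj : Function.Injective μ)
    (hμall : ∀ ν : (A → ℂ) → ℂ, IsLinearMap ℂ ν →
      (∀ x y : A → ℂ, ν (Pmul G x y) = ν x * ν y) → ν (delta G.one) = 1 →
      ∃ j, ν = μ j)
    -- `F_0, …, F_m` are the primitive idempotents, `μ_i(F_j) = δ_{ij}`, `∑ F_j = 1`:
    (F : Fin (m + 1) → (A → ℂ))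
    (hF : ∀ i j, μ i (F j) = if i = j then 1 else 0)
    (hFsum : ∑ j, F j = delta G.one)
    -- the nonzero scalars `n_j` with `τ(F_j) = 1/n_j`:
    (n : Fin (m + 1) → ℂ)
    (hn : ∀ j, n j ≠ 0)
    (hτF : ∀ j, F j G.one = 1 / n j)
    :
    ∑ j, n j • (F j ⊗ₜ[ℂ] F j)
      = ∑ a : A, (delta a) ⊗ₜ[ℂ] ((wt G a : ℂ) • delta (G.star a)) := by
  have hexp (x : A → ℂ) : ∑ j, μ j x • F j = x :=
    sum_dual_smul_eq μ hμlin F hF (by simp [hcard]) x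
  have hmul (a : A) (j : Fin (m + 1)) : Pmul G (delta a) (F j) = μ j (delta a) • F j := by
    rw [← hexp (Pmul G (delta a) (F j))]
    simp [hμmul, hF]
  have hcoef (a : A) (j : Fin (m + 1)) :
      n j * F j (G.star a) = μ j (delta a) * (wt G a : ℂ) := by
    have h := congrFun (hmul a j) G.one
    rw [G.Pmul_delta_one, Pi.smul_apply, hτF, smul_eq_mul] at h
    have hp : (G.p a (G.star a) G.one : ℂ) ≠ 0 := by
      exact_mod_cast (G.star_pos a).ne'
    have hnj := hn j
    simp only [wt, Complex.ofReal_div, Complex.ofReal_one]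
    field_simp at h ⊢
    linear_combination h
  have hnF (j : Fin (m + 1)) :
      n j • F j = ∑ a, μ j (delta a) • ((wt G a : ℂ) • delta (G.star a)) := by
    conv_lhs => rw [← sum_smul_delta (F j)]
    have hstar : Function.Involutive G.star := G.star_star
    rw [← hstar.bijective.sum_comp (fun a => F j a • delta a), Finset.smul_sum]
    exact Finset.sum_congr rfl fun a _ => by rw [smul_smul, smul_smul, hcoef]
  calc ∑ j, n j • (F j ⊗ₜ[ℂ] F j)
      = ∑ j, ∑ a, (μ j (delta a) • F j) ⊗ₜ[ℂ] ((wt G a : ℂ) • delta (G.star a)) := by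
        refine Finset.sum_congr rfl fun j _ => ?_
        rw [← TensorProduct.tmul_smul, hnF, TensorProduct.tmul_sum]
        exact Finset.sum_congr rfl fun a _ => (TensorProduct.smul_tmul _ _ _).symm
    _ = ∑ a, delta a ⊗ₜ[ℂ] ((wt G a : ℂ) • delta (G.star a)) := by
        rw [Finset.sum_comm]
        exact Finset.sum_congr rfl fun a _ => by rw [← TensorProduct.sum_tmul, hexp]
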